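/- Closed form for the one-dimensional quadratic Kantorovich problem: let μ and ν be probability measures on ℝ with finite second moments. The quantile coupling π* := (t ↦ (F_μ†(t), F_ν†(t)))_# 𝕌 is a coupling of μ and ν (its marginals are μ and ν), its cost is ∫ |x − y|² dπ*(x,y) = ∫₀¹ |F_μ†(t) − F_ν†(t)|² dt, and for every probability measure π on ℝ × ℝ with first marginal μ and second marginal ν one has ∫₀¹ |F_μ†(t) − F_ν†(t)|² dt ≤ ∫ |x − y|² dπ(x,y). (Hence the squared Wasserstein distance W₂²(μ,ν) equals the squared L²([0,1]) distance of the CDTs.) -/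

import Mathlib

open MeasureTheory Set

/-- The cumulative distribution function (CDF) of a measure `ν` on `ℝ`. -/
noncomputable def Fcdf (ν : Measure ℝ) (x : ℝ) : ℝ := (ν (Iic x)).toReal

/-- The generalized inverse (quantile function) of the CDF of `ν`. -/
noncomputable def Fq (ν : Measure ℝ) (y : ℝ) : ℝ := sInf {x : ℝ | Fcdf ν x > y}

/-- The Lebesgue measure restricted to `[0,1]` (the uniform measure on `[0,1]`). -/
noncomputable def unif : Measure ℝ := volume.restrict (Icc (0:ℝ) 1)

theorem bddBelow_lt_Fcdf (ν : Measure ℝ) [IsProbabilityMeasure ν] {t : ℝ} (ht : 0 < t) :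
    BddBelow {x : ℝ | Fcdf ν x > t} := by
  have h := ProbabilityTheory.tendsto_cdf_atBot ν
  obtain ⟨x, hx⟩ := (h.eventually (gt_mem_nhds ht)).exists
  refine ⟨x, fun y hy => ?_⟩
  by_contra! hyx
  have h1 := ProbabilityTheory.monotone_cdf ν hyx.le
  rw [ProbabilityTheory.cdf_eq_real ν y] at h1
  have hy' : t < ν.real (Iic y) := hy
  linarith

theorem nonempty_lt_Fcdf (ν : Measure ℝ) [IsProbabilityMeasure ν] {t : ℝ} (ht : t < 1) :
    {x : ℝ | Fcdf ν x > t}.Nonempty := by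
  have h := ProbabilityTheory.tendsto_cdf_atTop ν
  obtain ⟨x, hx⟩ := (h.eventually (lt_mem_nhds ht)).exists
  rw [ProbabilityTheory.cdf_eq_real ν x] at hx
  exact ⟨x, hx⟩

theorem Fq_le_of_lt_Fcdf (ν : Measure ℝ) [IsProbabilityMeasure ν] {t x : ℝ} (ht : 0 < t)
    (h : t < Fcdf ν x) : Fq ν t ≤ x :=
  csInf_le (bddBelow_lt_Fcdf ν ht) h

theorem le_Fcdf_of_Fq_le (ν : Measure ℝ) [IsProbabilityMeasure ν] {t x : ℝ} (ht : t < 1)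
    (h : Fq ν t ≤ x) : t ≤ Fcdf ν x := by
  have hc : ContinuousWithinAt (ProbabilityTheory.cdf ν) (Ioi x) x :=
    ((ProbabilityTheory.cdf ν).right_continuous x).mono Ioi_subset_Ici_self
  have key : t ≤ ProbabilityTheory.cdf ν x := by
    refine ge_of_tendsto hc ?_
    filter_upwards [self_mem_nhdsWithin] with y hy
    obtain ⟨z, hz, hzy⟩ := exists_lt_of_csInf_lt (nonempty_lt_Fcdf ν ht) (h.trans_lt hy)
    have h1 := ProbabilityTheory.monotone_cdf ν hzy.le
    rw [ProbabilityTheory.cdf_eq_real ν z] at h1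
    exact (le_of_lt hz).trans h1
  rwa [ProbabilityTheory.cdf_eq_real ν x] at key

theorem unif_eq_restrict_Ioo : unif = volume.restrict (Ioo (0 : ℝ) 1) :=
  (Measure.restrict_congr_set Ioo_ae_eq_Icc).symm

theorem aemeasurable_Fq (ν : Measure ℝ) [IsProbabilityMeasure ν] :
    AEMeasurable (Fq ν) unif := by
  rw [unif_eq_restrict_Ioo]
  refine aemeasurable_restrict_of_monotoneOn measurableSet_Ioo fun s hs t ht hst => ?_
  exact csInf_le_csInf (bddBelow_lt_Fcdf ν hs.1) (nonempty_lt_Fcdf ν ht.2)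
    fun x hx => hst.trans_lt hx

theorem ofReal_Fcdf (ν : Measure ℝ) [IsProbabilityMeasure ν] (x : ℝ) :
    ENNReal.ofReal (Fcdf ν x) = ν (Iic x) :=
  ENNReal.ofReal_toReal (measure_ne_top ν _)

theorem map_Fq_unif (ν : Measure ℝ) [IsProbabilityMeasure ν] : unif.map (Fq ν) = ν := by
  have : IsProbabilityMeasure unif := by constructor; simp [unif]
  have := Measure.isProbabilityMeasure_map (aemeasurable_Fq ν)
  refine Measure.ext_of_Iic _ _ fun x => ?_
  rw [Measure.map_apply_of_aemeasurable (aemeasurable_Fq ν) measurableSet_Iic, ← ofReal_Fcdf ν x]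
  have h1 : Fcdf ν x ≤ 1 := by
    have := ProbabilityTheory.cdf_le_one ν x
    rwa [ProbabilityTheory.cdf_eq_real ν x] at this
  rw [unif_eq_restrict_Ioo, Measure.restrict_apply' measurableSet_Ioo]
  refine le_antisymm ?_ ?_
  · calc volume (Fq ν ⁻¹' Iic x ∩ Ioo 0 1) ≤ volume (Icc 0 (Fcdf ν x)) :=
          measure_mono fun t ht => ⟨ht.2.1.le, le_Fcdf_of_Fq_le ν ht.2.2 ht.1⟩
      _ = _ := by simp
  · calc ENNReal.ofReal (Fcdf ν x) = volume (Ioo 0 (Fcdf ν x)) := by simp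
      _ ≤ volume (Fq ν ⁻¹' Iic x ∩ Ioo 0 1) := measure_mono fun t ht =>
          ⟨Fq_le_of_lt_Fcdf ν ht.1 ht.2, ht.1, ht.2.trans_le h1⟩

/-- The squared distance on the line is the area of a square, cut out by conditions on the
minimum and the maximum of the coordinates. -/
theorem ofReal_abs_sub_sq_eq_volume (x y : ℝ) :
    ENNReal.ofReal (|x - y| ^ 2) =
      volume {p : ℝ × ℝ | x ≤ min p.1 p.2 ∧ max p.1 p.2 < y} +
      volume {p : ℝ × ℝ | y ≤ min p.1 p.2 ∧ max p.1 p.2 < x} := by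
  have key (u v : ℝ) : volume {p : ℝ × ℝ | u ≤ min p.1 p.2 ∧ max p.1 p.2 < v} =
      ENNReal.ofReal (v - u) ^ 2 := by
    have : {p : ℝ × ℝ | u ≤ min p.1 p.2 ∧ max p.1 p.2 < v} = Ico u v ×ˢ Ico u v := by
      ext p
      simp only [mem_ofPred_eq, le_min_iff, max_lt_iff, mem_prod, mem_Ico]
      tauto
    rw [this, Measure.volume_eq_prod, Measure.prod_prod, Real.volume_Ico, sq]
  rw [key, key, ENNReal.ofReal_pow (abs_nonneg _)]
  rcases le_total x y with h | h
  · rw [ENNReal.ofReal_of_nonpos (sub_nonpos.2 h), abs_sub_comm, abs_of_nonneg (sub_nonneg.2 h)]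
    simp
  · rw [ENNReal.ofReal_of_nonpos (sub_nonpos.2 h), abs_of_nonneg (sub_nonneg.2 h)]
    simp

theorem measurableSet_section_region {f g : ℝ × ℝ → ℝ} (hf : Measurable f) (hg : Measurable g) :
    MeasurableSet {z : (ℝ × ℝ) × (ℝ × ℝ) |
      f z.1 ≤ min z.2.1 z.2.2 ∧ max z.2.1 z.2.2 < g z.1} := by
  rw [ofPred_and]
  exact (measurableSet_le (by fun_prop) (by fun_prop)).inter
    (measurableSet_lt (by fun_prop) (by fun_prop))

theorem lintegral_volume_section (π : Measure (ℝ × ℝ)) [SFinite π] {f g : ℝ × ℝ → ℝ}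
    (hf : Measurable f) (hg : Measurable g) :
    ∫⁻ q, volume {p : ℝ × ℝ | f q ≤ min p.1 p.2 ∧ max p.1 p.2 < g q} ∂π =
      ∫⁻ p : ℝ × ℝ, π {q | f q ≤ min p.1 p.2 ∧ max p.1 p.2 < g q} := by
  have hS := measurableSet_section_region hf hg
  exact (Measure.prod_apply hS).symm.trans (Measure.prod_apply_symm hS)

/-- Layer-cake formula for the quadratic transport cost on the line. -/
theorem lintegral_abs_sub_sq_eq (π : Measure (ℝ × ℝ)) [SFinite π] :
    ∫⁻ q : ℝ × ℝ, ENNReal.ofReal (|q.1 - q.2| ^ 2) ∂π =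
      (∫⁻ p : ℝ × ℝ, π {q | q.1 ≤ min p.1 p.2 ∧ max p.1 p.2 < q.2}) +
      ∫⁻ p : ℝ × ℝ, π {q | q.2 ≤ min p.1 p.2 ∧ max p.1 p.2 < q.1} := by
  simp_rw [ofReal_abs_sub_sq_eq_volume]
  rw [lintegral_add_left, lintegral_volume_section π measurable_fst measurable_snd,
    lintegral_volume_section π measurable_snd measurable_fst]
  exact measurable_measure_prodMk_left (measurableSet_section_region measurable_fst measurable_snd)

theorem sub_le_measure_le_and_lt {Ω : Type*} [MeasurableSpace Ω] (π : Measure Ω) {f g : Ω → ℝ}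
    (hf : Measurable f) (hg : Measurable g) (a b : ℝ) :
    π.map f (Iic a) - π.map g (Iic b) ≤ π {q | f q ≤ a ∧ b < g q} := by
  rw [tsub_le_iff_right, Measure.map_apply hf measurableSet_Iic,
    Measure.map_apply hg measurableSet_Iic]
  refine (measure_mono fun q hq => ?_).trans (measure_union_le _ _)
  rcases lt_or_ge b (g q) with h | h
  · exact Or.inl ⟨hq, h⟩
  · exact Or.inr h

theorem unif_Fq_le_and_lt_Fq_le (μ ν : Measure ℝ) [IsProbabilityMeasure μ]
    [IsProbabilityMeasure ν] (a b : ℝ) :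
    unif {t | Fq μ t ≤ a ∧ b < Fq ν t} ≤ μ (Iic a) - ν (Iic b) := by
  rw [unif_eq_restrict_Ioo, Measure.restrict_apply' measurableSet_Ioo, ← ofReal_Fcdf μ,
    ← ofReal_Fcdf ν, ← ENNReal.ofReal_sub _ (show 0 ≤ Fcdf ν b from ENNReal.toReal_nonneg), ← Real.volume_Icc]
  refine measure_mono fun t ht => ⟨?_, le_Fcdf_of_Fq_le μ ht.2.2 ht.1.1⟩
  by_contra! h
  exact (Fq_le_of_lt_Fcdf ν ht.2.1 h).not_gt ht.1.2

/-- Closed form for the 1D quadratic Kantorovich problem: the quantile coupling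
`π* = (t ↦ (F_μ†(t), F_ν†(t)))_# 𝕌` is a coupling of `μ` and `ν`, its quadratic cost equals
`∫₀¹ |F_μ† − F_ν†|²`, and this value is a lower bound for the cost of any coupling. -/
theorem quantile_coupling_optimal (μ ν : Measure ℝ)
    [IsProbabilityMeasure μ] [IsProbabilityMeasure ν]
    (hμ2 : Integrable (fun x => x ^ 2) μ) (hν2 : Integrable (fun x => x ^ 2) ν) :
    Measure.map Prod.fst (Measure.map (fun t => (Fq μ t, Fq ν t)) unif) = μ ∧
    Measure.map Prod.snd (Measure.map (fun t => (Fq μ t, Fq ν t)) unif) = ν ∧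
    (∫⁻ p : ℝ × ℝ, ENNReal.ofReal (|p.1 - p.2| ^ 2)
        ∂(Measure.map (fun t => (Fq μ t, Fq ν t)) unif)
      = ∫⁻ t, ENNReal.ofReal (|Fq μ t - Fq ν t| ^ 2) ∂unif) ∧
    ∀ π : Measure (ℝ × ℝ), IsProbabilityMeasure π →
      Measure.map Prod.fst π = μ → Measure.map Prod.snd π = ν →
      ∫⁻ t, ENNReal.ofReal (|Fq μ t - Fq ν t| ^ 2) ∂unif
        ≤ ∫⁻ p : ℝ × ℝ, ENNReal.ofReal (|p.1 - p.2| ^ 2) ∂π := by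
  have hpair := (aemeasurable_Fq μ).prodMk (aemeasurable_Fq ν)
  have hcost : ∫⁻ p : ℝ × ℝ, ENNReal.ofReal (|p.1 - p.2| ^ 2)
      ∂(Measure.map (fun t => (Fq μ t, Fq ν t)) unif)
      = ∫⁻ t, ENNReal.ofReal (|Fq μ t - Fq ν t| ^ 2) ∂unif :=
    lintegral_map' (by fun_prop) hpair
  refine ⟨?_, ?_, hcost, fun π _ h1 h2 => ?_⟩
  · rw [AEMeasurable.map_map_of_aemeasurable measurable_fst.aemeasurable hpair]
    exact map_Fq_unif μ
  · rw [AEMeasurable.map_map_of_aemeasurable measurable_snd.aemeasurable hpair]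
    exact map_Fq_unif ν
  · have : SFinite unif := by unfold unif; infer_instance
    rw [← hcost, lintegral_abs_sub_sq_eq, lintegral_abs_sub_sq_eq]
    refine add_le_add (lintegral_mono fun p => ?_) (lintegral_mono fun p => ?_)
    · have hs : MeasurableSet {q : ℝ × ℝ | q.1 ≤ min p.1 p.2 ∧ max p.1 p.2 < q.2} :=
        (measurableSet_le measurable_fst measurable_const).inter
          (measurableSet_lt measurable_const measurable_snd)
      rw [Measure.map_apply_of_aemeasurable hpair hs]
      refine (unif_Fq_le_and_lt_Fq_le μ ν _ _).trans ?_
      simpa only [h1, h2] using sub_le_measure_le_and_lt π measurable_fst measurable_snd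
        (min p.1 p.2) (max p.1 p.2)
    · have hs : MeasurableSet {q : ℝ × ℝ | q.2 ≤ min p.1 p.2 ∧ max p.1 p.2 < q.1} :=
        (measurableSet_le measurable_snd measurable_const).inter
          (measurableSet_lt measurable_const measurable_fst)
      rw [Measure.map_apply_of_aemeasurable hpair hs]
      refine (unif_Fq_le_and_lt_Fq_le ν μ _ _).trans ?_
      simpa only [h1, h2] using sub_le_measure_le_and_lt π measurable_snd measurable_fst
        (min p.1 p.2) (max p.1 p.2)
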